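/- Let 𝔤 be a Lie algebra over ℝ, let ε ∈ ℝ, and let L, a₀, a₁, b₀, b₁ ∈ 𝔤 satisfy: ⁅b₀,L⁆ = ε·L, ⁅L,a₀⁆ = b₁, ⁅L,b₁⁆ = a₁, ⁅a₀,b₀⁆ = 0, and ⁅a₀,b₁⁆ + ⁅a₁,b₀⁆ = 0. Then ε²·a₁ = 0. Consequently, if ε ≠ 0 then a₁ = 0. -/

import Mathlib

/-- Appendix B: the prolongation relations of `u_tt + ε u_t = (e^u)_xx` force
`ε² a₁ = 0`; hence for `ε ≠ 0` the prolongation algebra truncates (`a₁ = 0`). -/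
theorem prolongation_truncation {𝔤 : Type*} [LieRing 𝔤] [LieAlgebra ℝ 𝔤]
    (ε : ℝ) (L a₀ a₁ b₀ b₁ : 𝔤)
    (h1 : ⁅b₀, L⁆ = ε • L)
    (h2 : ⁅L, a₀⁆ = b₁)
    (h3 : ⁅L, b₁⁆ = a₁)
    (h4 : ⁅a₀, b₀⁆ = 0)
    (h5 : ⁅a₀, b₁⁆ + ⁅a₁, b₀⁆ = 0) :
    (ε ^ 2) • a₁ = 0 ∧ (ε ≠ 0 → a₁ = 0) := by
  have h4' : ⁅b₀, a₀⁆ = 0 := by rw [← lie_skew, h4, neg_zero]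
  have d1 : ⁅b₀, b₁⁆ = ε • b₁ := by
    have h := leibniz_lie b₀ L a₀
    rw [h1, h4', lie_zero, add_zero, smul_lie, h2] at h
    exact h
  have d2 : ⁅b₀, a₁⁆ = (2 * ε) • a₁ := by
    have h := leibniz_lie b₀ L b₁
    rw [h1, d1, smul_lie, lie_smul, h3] at h
    rw [h]; module
  have d3 : ⁅a₀, b₁⁆ = (2 * ε) • a₁ := by
    rw [← lie_skew a₁ b₀, d2] at h5
    exact add_neg_eq_zero.mp h5
  have key : (ε ^ 2) • a₁ = 0 := by
    have h := leibniz_lie b₀ a₀ b₁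
    rw [h4', zero_lie, zero_add, d1, lie_smul, d3, lie_smul, d2] at h
    have h' : (2 : ℝ) • ((ε ^ 2) • a₁) = 0 := by
      have := sub_eq_zero.mpr h
      rw [← this]; module
    exact (smul_eq_zero.mp h').resolve_left two_ne_zero
  exact ⟨key, fun hε => (smul_eq_zero.mp key).resolve_left (pow_ne_zero 2 hε)⟩
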